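/- Let d be a positive integer, fix an index o in {1,…,d}³, and for unitaries U₁, U₂, U₃ ∈ U(d³), each viewed as a matrix indexed by triples in {1,…,d}³, define the random tensor Ψ(a₁,a₂,a₃) = d^{−3/2} Σ_{x,y,z=1}^{d} U₁((a₁,x,z),o) · U₂((a₂,x,y),o) · U₃((a₃,y,z),o). Then ∫∫∫ Σ_{a₁,a₂,b₁,b₂} | Σ_{c=1}^{d} Ψ(a₁,a₂,c) · conj(Ψ(b₁,b₂,c)) |² dμ(U₁) dμ(U₂) dμ(U₃) = (1 + d²) / ( d⁸ (d+1) (d² − d + 1)³ ). -/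

import Mathlib

open MeasureTheory Matrix

noncomputable instance {ι : Type*} [Fintype ι] [DecidableEq ι] :
    MeasurableSpace (Matrix.unitaryGroup ι ℂ) := borel _

instance {ι : Type*} [Fintype ι] [DecidableEq ι] :
    BorelSpace (Matrix.unitaryGroup ι ℂ) := ⟨rfl⟩


section Moments
variable {ι : Type*} [Fintype ι] [DecidableEq ι]

/-- the quartic monomial -/
def quart (o i j k l : ι) (U : Matrix.unitaryGroup ι ℂ) : ℂ :=
  (U : Matrix ι ι ℂ) i o * (U : Matrix ι ι ℂ) j o *
    ((starRingEnd ℂ) ((U : Matrix ι ι ℂ) k o) * (starRingEnd ℂ) ((U : Matrix ι ι ℂ) l o))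

lemma quart_cont (o i j k l : ι) : Continuous (quart o i j k l) := by
  have h : ∀ i : ι, Continuous (fun U : Matrix.unitaryGroup ι ℂ => (U : Matrix ι ι ℂ) i o) :=
    fun i => continuous_subtype_val.matrix_elem i o
  have h' : ∀ i : ι, Continuous (fun U : Matrix.unitaryGroup ι ℂ =>
    (starRingEnd ℂ) ((U : Matrix ι ι ℂ) i o)) := fun i => Complex.continuous_conj.comp (h i)
  exact ((h i).mul (h j)).mul ((h' k).mul (h' l))

lemma quart_int (μ : Measure (Matrix.unitaryGroup ι ℂ)) [IsProbabilityMeasure μ]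
    (o i j k l : ι) : Integrable (quart o i j k l) μ := by
  haveI : SecondCountableTopology (Matrix ι ι ℂ) :=
    inferInstanceAs (SecondCountableTopology (ι → ι → ℂ))
  refine Integrable.of_bound (C := 1) (quart_cont o i j k l).aestronglyMeasurable ?_
  refine Filter.Eventually.of_forall fun U => ?_
  have h : ∀ i : ι, ‖(U : Matrix ι ι ℂ) i o‖ ≤ 1 := fun i => entry_norm_bound_of_unitary U.2 i o
  simp only [quart, norm_mul, RCLike.norm_conj]
  have h1 := mul_le_one₀ (h i) (norm_nonneg _) (h j)
  have h2 := mul_le_one₀ (h k) (norm_nonneg _) (h l)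
  exact mul_le_one₀ h1 (by positivity) h2

/-- the moment -/
noncomputable def mom (μ : Measure (Matrix.unitaryGroup ι ℂ)) (o i j k l : ι) : ℂ :=
  ∫ U, quart o i j k l U ∂μ

lemma mom_inv (μ : Measure (Matrix.unitaryGroup ι ℂ)) [μ.IsHaarMeasure]
    (V : Matrix.unitaryGroup ι ℂ) (o i j k l : ι) :
    ∫ U, quart o i j k l (V * U) ∂μ = mom μ o i j k l :=
  integral_mul_left_eq_self (μ := μ) (quart o i j k l) V

/-- phase -/
noncomputable def phs (m : ι) : ι → ℂ := fun x => if x = m then Complex.I else 1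

noncomputable def phU (m : ι) : Matrix.unitaryGroup ι ℂ :=
  ⟨Matrix.diagonal (phs m), by
    rw [Matrix.mem_unitaryGroup_iff, Matrix.star_eq_conjTranspose, Matrix.diagonal_conjTranspose,
      Matrix.diagonal_mul_diagonal, ← Matrix.diagonal_one]
    congr 1
    ext x
    by_cases h : x = m <;> simp [phs, h]⟩

lemma mom_phase (μ : Measure (Matrix.unitaryGroup ι ℂ)) [μ.IsHaarMeasure]
    (m o i j k l : ι) :
    mom μ o i j k l = phs m i * phs m j * ((starRingEnd ℂ) (phs m k) * (starRingEnd ℂ) (phs m l))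
      * mom μ o i j k l := by
  conv_lhs => rw [← mom_inv μ (phU m)]
  rw [mom, ← integral_const_mul]
  congr 1
  ext U
  simp only [quart, Submonoid.coe_mul, phU, Matrix.diagonal_mul, map_mul]
  ring

lemma mom_zero (μ : Measure (Matrix.unitaryGroup ι ℂ)) [μ.IsHaarMeasure]
    (o i j k l : ι) (h : ¬ ((i = k ∧ j = l) ∨ (i = l ∧ j = k))) : mom μ o i j k l = 0 := by
  have key : ∀ c x : ℂ, x = c * x → c ≠ 1 → x = 0 := by
    intro c x hx hc
    have : (c - 1) * x = 0 := by linear_combination -hx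
    rcases mul_eq_zero.1 this with h | h
    · exact absurd (sub_eq_zero.1 h) hc
    · exact h
  have hI : Complex.I ≠ 1 := by intro h; simpa using congrArg Complex.re h
  have hI2 : -Complex.I ≠ 1 := by intro h; simpa using congrArg Complex.re h
  have hm : (-1 : ℂ) ≠ 1 := by norm_num
  by_cases hik : i = k
  · subst hik
    have hjl : j ≠ l := by tauto
    by_cases hij : j = i
    · subst hij
      refine key _ _ (mom_phase μ l o _ _ _ _) ?_
      simp [phs, hjl, hI2]
    · refine key _ _ (mom_phase μ j o _ _ _ _) ?_
      simp [phs, hjl.symm, Ne.symm hij, hI]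
  · by_cases hil : i = l
    · subst hil
      have hjl : j ≠ k := by tauto
      by_cases hij : j = i
      · subst hij
        refine key _ _ (mom_phase μ k o _ _ _ _) ?_
        simp [phs, hjl, hI2]
      · refine key _ _ (mom_phase μ j o _ _ _ _) ?_
        simp [phs, hjl.symm, Ne.symm hij, hI]
    · refine key _ _ (mom_phase μ i o _ _ _ _) ?_
      by_cases hij : j = i
      · subst hij
        simp [phs, Ne.symm hik, Ne.symm hil, hm]
      · simp [phs, Ne.symm hik, Ne.symm hil, hij, hI]

/-- Householder vector -/
noncomputable def hw (i j : ι) : ι → ℂ := fun x => (if x = i then 1 else 0) - (if x = j then 2 else 0)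

lemma hw_dot (i j : ι) (f : ι → ℂ) : hw i j ⬝ᵥ f = f i - 2 * f j := by
  simp [hw, dotProduct, sub_mul, Finset.sum_sub_distrib]

noncomputable def hU (i j : ι) (h : i ≠ j) : Matrix.unitaryGroup ι ℂ :=
  ⟨1 - (2/5 : ℂ) • Matrix.vecMulVec (hw i j) (hw i j), by
    have hs : star (1 - (2/5 : ℂ) • Matrix.vecMulVec (hw i j) (hw i j)) =
        1 - (2/5 : ℂ) • Matrix.vecMulVec (hw i j) (hw i j) := by
      have hr : star (2/5 : ℂ) = 2/5 := by simp
      ext x y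
      simp only [Matrix.star_apply, Matrix.sub_apply, Matrix.smul_apply, Matrix.vecMulVec_apply,
        star_sub, smul_eq_mul, star_mul', hr, hw]
      have : ∀ x i : ι, ∀ c : ℝ, star (if x = i then (c:ℂ) else 0) = if x = i then (c:ℂ) else 0 := by
        intro x i c; split_ifs <;> simp
      have h1 := fun x i => this x i 1
      have h2 := fun x i => this x i 2
      simp only [Complex.ofReal_one, Complex.ofReal_ofNat] at h1 h2
      rw [h1, h1, h2, h2, Matrix.one_apply, Matrix.one_apply]
      rw [apply_ite star]
      simp only [star_one, star_zero, eq_comm (a := x) (b := y)]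
      ring
    rw [Matrix.mem_unitaryGroup_iff, hs]
    have hd : hw i j ⬝ᵥ hw i j = 5 := by
      rw [hw_dot]; simp [hw, h, h.symm]; norm_num
    rw [sub_mul, mul_sub, mul_sub, one_mul, mul_one, one_mul, smul_mul_smul_comm,
      Matrix.vecMulVec_mul_vecMulVec, hd]
    ext x y
    simp only [Matrix.sub_apply, Matrix.smul_apply, Matrix.vecMulVec_apply, smul_eq_mul, Pi.smul_apply]
    ring⟩

lemma hU_apply (i j : ι) (h : i ≠ j) (U : Matrix.unitaryGroup ι ℂ) (o : ι) :
    ((hU i j h * U : Matrix.unitaryGroup ι ℂ) : Matrix ι ι ℂ) i o =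
      3/5 * (U : Matrix ι ι ℂ) i o + 4/5 * (U : Matrix ι ι ℂ) j o := by
  have : ∀ M : Matrix ι ι ℂ, ((1 - (2/5 : ℂ) • Matrix.vecMulVec (hw i j) (hw i j)) * M) i o =
      M i o - 2/5 * (hw i j i * (hw i j ⬝ᵥ fun x => M x o)) := by
    intro M
    rw [sub_mul, one_mul, smul_mul_assoc]
    simp only [Matrix.sub_apply, Matrix.smul_apply, smul_eq_mul, Matrix.mul_apply,
      Matrix.vecMulVec_apply, dotProduct, Finset.mul_sum, mul_assoc]
  rw [Submonoid.coe_mul]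
  refine (this _).trans ?_
  rw [hw_dot]
  simp [hw, h]
  ring

lemma mom_rot (μ : Measure (Matrix.unitaryGroup ι ℂ)) [μ.IsHaarMeasure] [IsProbabilityMeasure μ]
    (o i j : ι) (h : i ≠ j) :
    mom μ o i i i i = 81/625 * mom μ o i i i i + 256/625 * mom μ o j j j j +
      576/625 * mom μ o i j i j := by
  have h1 : ∀ U : Matrix.unitaryGroup ι ℂ, quart o i i i i (hU i j h * U) =
      ∑ e₁ : Fin 2, ∑ e₂ : Fin 2, ∑ e₃ : Fin 2, ∑ e₄ : Fin 2,
        ((![3/5, 4/5] e₁ * ![3/5,4/5] e₂ * (![3/5,4/5] e₃ * ![3/5,4/5] e₄) : ℂ)) *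
          quart o (![i,j] e₁) (![i,j] e₂) (![i,j] e₃) (![i,j] e₄) U := by
    intro U
    simp only [quart, hU_apply, Fin.sum_univ_two, map_add, map_mul, map_div₀, map_ofNat]
    simp
    ring
  have hsw : ∀ i j k l, mom μ o i j k l = mom μ o j i k l := by
    intro i j k l; unfold mom; congr 1; ext U; unfold quart; ring
  have hsw' : ∀ i j k l, mom μ o i j k l = mom μ o i j l k := by
    intro i j k l; unfold mom; congr 1; ext U; unfold quart; ring
  have h2 := mom_inv μ (hU i j h) o i i i i
  simp only [h1] at h2
  have hint : ∀ e₁ e₂ e₃ e₄ : Fin 2, Integrable (fun U => 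
      ((![3/5, 4/5] e₁ * ![3/5,4/5] e₂ * (![3/5,4/5] e₃ * ![3/5,4/5] e₄) : ℂ)) *
          quart o (![i,j] e₁) (![i,j] e₂) (![i,j] e₃) (![i,j] e₄) U) μ :=
    fun _ _ _ _ => (quart_int μ _ _ _ _ _).const_mul _
  rw [integral_finsetSum _ fun e₁ _ => integrable_finsetSum _ fun e₂ _ =>
    integrable_finsetSum _ fun e₃ _ => integrable_finsetSum _ fun e₄ _ => hint e₁ e₂ e₃ e₄] at h2
  have h3 : ∀ e₁ : Fin 2, (∫ U, ∑ e₂ : Fin 2, ∑ e₃ : Fin 2, ∑ e₄ : Fin 2,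
        ((![3/5, 4/5] e₁ * ![3/5,4/5] e₂ * (![3/5,4/5] e₃ * ![3/5,4/5] e₄) : ℂ)) *
          quart o (![i,j] e₁) (![i,j] e₂) (![i,j] e₃) (![i,j] e₄) U ∂μ) =
      ∑ e₂ : Fin 2, ∑ e₃ : Fin 2, ∑ e₄ : Fin 2,
        ((![3/5, 4/5] e₁ * ![3/5,4/5] e₂ * (![3/5,4/5] e₃ * ![3/5,4/5] e₄) : ℂ)) *
          mom μ o (![i,j] e₁) (![i,j] e₂) (![i,j] e₃) (![i,j] e₄) := by
    intro e₁
    rw [integral_finsetSum _ fun e₂ _ =>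
      integrable_finsetSum _ fun e₃ _ => integrable_finsetSum _ fun e₄ _ => hint e₁ e₂ e₃ e₄]
    refine Finset.sum_congr rfl fun e₂ _ => ?_
    rw [integral_finsetSum _ fun e₃ _ => integrable_finsetSum _ fun e₄ _ => hint e₁ e₂ e₃ e₄]
    refine Finset.sum_congr rfl fun e₃ _ => ?_
    rw [integral_finsetSum _ fun e₄ _ => hint e₁ e₂ e₃ e₄]
    refine Finset.sum_congr rfl fun e₄ _ => ?_
    rw [integral_const_mul, mom]
  simp only [h3] at h2
  simp only [Fin.sum_univ_two, Matrix.cons_val_zero, Matrix.cons_val_one] at h2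
  rw [hsw j i i j, hsw' i j j i, hsw j i j i, hsw' i j j i] at h2
  have z : ∀ a b c e, ¬ ((a = c ∧ b = e) ∨ (a = e ∧ b = c)) → mom μ o a b c e = 0 :=
    fun a b c e => mom_zero μ o a b c e
  have hh := h.symm
  rw [z i i i j (by simp [h]), z i i j i (by simp [h]), z i i j j (by simp [h]),
    z i j i i (by simp [hh]), z i j j j (by simp [h]), z j i i i (by simp [hh]),
    z j i j j (by simp [h]), z j j i i (by simp [hh]), z j j i j (by simp [hh]),
    z j j j i (by simp [hh])] at h2
  linear_combination -h2

lemma mom_norm (μ : Measure (Matrix.unitaryGroup ι ℂ)) [μ.IsHaarMeasure] [IsProbabilityMeasure μ]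
    (o : ι) : ∑ i, ∑ j, mom μ o i j i j = 1 := by
  have h0 : ∀ U : Matrix.unitaryGroup ι ℂ, ∑ i, ∑ j, quart o i j i j U = 1 := by
    intro U
    have h := congrFun (congrFun (Matrix.mem_unitaryGroup_iff'.1 U.2) o) o
    simp only [Matrix.mul_apply, Matrix.star_apply, Matrix.one_apply_eq] at h
    calc _ = (∑ i, star ((U : Matrix ι ι ℂ) i o) * (U : Matrix ι ι ℂ) i o) *
        (∑ i, star ((U : Matrix ι ι ℂ) i o) * (U : Matrix ι ι ℂ) i o) := by
          rw [Finset.sum_mul_sum]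
          refine Finset.sum_congr rfl fun i _ => Finset.sum_congr rfl fun j _ => ?_
          simp only [quart, starRingEnd_apply]; ring
      _ = 1 := by rw [h, one_mul]
  have h1 : ∫ U, ∑ i, ∑ j, quart o i j i j U ∂μ = 1 := by
    simp [h0]
  rw [integral_finsetSum _ fun i _ => integrable_finsetSum _ fun j _ => quart_int μ o i j i j] at h1
  rw [← h1]
  refine Finset.sum_congr rfl fun i _ => ?_
  rw [integral_finsetSum _ fun j _ => quart_int μ o i j i j]
  rfl

lemma mom_eq (μ : Measure (Matrix.unitaryGroup ι ℂ)) [μ.IsHaarMeasure] [IsProbabilityMeasure μ]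
    (o i j k l : ι) : mom μ o i j k l =
      ((if i = k ∧ j = l then 1 else 0) + (if i = l ∧ j = k then 1 else 0)) /
        ((Fintype.card ι : ℂ) * (Fintype.card ι + 1)) := by
  set a := mom μ o o o o o with ha
  have hdiag : ∀ i, mom μ o i i i i = a := by
    intro i
    by_cases h : i = o
    · rw [h]
    · have h1 := mom_rot μ o i o h
      have h2 := mom_rot μ o o i (Ne.symm h)
      have h3 : mom μ o o i o i = mom μ o i o i o := by
        unfold mom; congr 1; ext U; unfold quart; ring
      rw [h3] at h2
      linear_combination (625/800) * (h1 - h2)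
  have hoff : ∀ i j, i ≠ j → mom μ o i j i j = a / 2 := by
    intro i j h
    have h1 := mom_rot μ o i j h
    rw [hdiag, hdiag] at h1
    linear_combination -(625/576) * h1
  have hoff' : ∀ i j, i ≠ j → mom μ o i j j i = a / 2 := by
    intro i j h
    rw [← hoff i j h]
    unfold mom; congr 1; ext U; unfold quart; ring
  have hall : mom μ o i j k l = a / 2 *
      ((if i = k ∧ j = l then 1 else 0) + (if i = l ∧ j = k then 1 else 0)) := by
    by_cases h : (i = k ∧ j = l) ∨ (i = l ∧ j = k)
    · by_cases hij : i = j
      · subst hij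
        have hk : i = k := by tauto
        have hl : i = l := by tauto
        subst hk; subst hl
        simp [hdiag]; ring
      · rcases h with ⟨rfl, rfl⟩ | ⟨rfl, rfl⟩
        · rw [hoff _ _ hij]; simp [hij]
        · rw [hoff' _ _ hij]; simp [hij]
    · rw [mom_zero μ o i j k l h]
      rw [not_or] at h
      simp [h.1, h.2]
  have hsum : ∀ i j, mom μ o i j i j = a / 2 * (1 + if i = j then 1 else 0) := by
    intro i j
    by_cases h : i = j
    · subst h; rw [hdiag]; simp; ring
    · rw [hoff i j h]; simp [h]
  have hn := mom_norm μ o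
  simp only [hsum, ← Finset.mul_sum, Finset.sum_add_distrib] at hn
  simp at hn
  have hc : (Fintype.card ι : ℂ) ≠ 0 := by
    haveI : Nonempty ι := ⟨o⟩
    exact_mod_cast Fintype.card_ne_zero
  have hc1 : (Fintype.card ι : ℂ) + 1 ≠ 0 := by exact Nat.cast_add_one_ne_zero _
  rw [hall, eq_div_iff (mul_ne_zero hc hc1)]
  linear_combination ((if i = k ∧ j = l then 1 else 0) + (if i = l ∧ j = k then 1 else 0)) * hn

end Moments

lemma triple_int {G S : Type*} [MeasurableSpace G] (μ : Measure G) [IsProbabilityMeasure μ]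
    [Fintype S] (A B C : S → G → ℂ) (hA : ∀ s, Integrable (A s) μ) (hB : ∀ s, Integrable (B s) μ)
    (hC : ∀ s, Integrable (C s) μ) :
    ∫ u, ∫ v, ∫ w, ∑ s, A s u * B s v * C s w ∂μ ∂μ ∂μ =
      ∑ s, (∫ u, A s u ∂μ) * (∫ u, B s u ∂μ) * (∫ u, C s u ∂μ) := by
  have h1 : ∀ u v, ∫ w, ∑ s, A s u * B s v * C s w ∂μ = ∑ s, A s u * B s v * ∫ w, C s w ∂μ := by
    intro u v
    rw [integral_finsetSum _ fun s _ => (hC s).const_mul _]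
    simp only [integral_const_mul]
  have h2 : ∀ u, ∫ v, ∑ s, A s u * B s v * ∫ w, C s w ∂μ ∂μ =
      ∑ s, A s u * (∫ v, B s v ∂μ) * ∫ w, C s w ∂μ := by
    intro u
    rw [integral_finsetSum _ fun s _ => ((hB s).const_mul _).mul_const _]
    simp only [integral_const_mul, integral_mul_const]
  simp only [h1, h2]
  rw [integral_finsetSum _ fun s _ => ((hA s).mul_const _).mul_const _]
  simp only [integral_mul_const]

/-- pairing delta -/
def dl {α : Type*} [DecidableEq α] (s : Bool) (i j k l : α) : ℂ :=
  if s then (if i = k then 1 else 0) * (if j = l then 1 else 0)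
  else (if i = l then 1 else 0) * (if j = k then 1 else 0)

lemma mom_triple (d : ℕ) (o : Fin d × Fin d × Fin d)
    (μ : Measure (Matrix.unitaryGroup (Fin d × Fin d × Fin d) ℂ))
    [μ.IsHaarMeasure] [IsProbabilityMeasure μ] (a b c e x y z w p q r t : Fin d) :
    ∫ U, quart o (a, x, p) (b, y, q) (c, z, r) (e, w, t) U ∂μ =
      ((d:ℂ)^3 * ((d:ℂ)^3 + 1))⁻¹ *
        ∑ s : Bool, dl s a b c e * dl s x y z w * dl s p q r t := by
  have h := mom_eq μ o (a, x, p) (b, y, q) (c, z, r) (e, w, t)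
  rw [mom] at h
  rw [h]
  have hcard : (Fintype.card (Fin d × Fin d × Fin d) : ℂ) = (d:ℂ)^3 := by
    simp; ring
  rw [hcard, div_eq_inv_mul]
  congr 1
  rw [Fintype.sum_bool]
  simp only [dl, Prod.mk.injEq, if_true, Bool.false_eq_true, if_false, ← ite_and, mul_ite, mul_one, mul_zero, ite_and]
  congr 1 <;> split_ifs <;> simp_all

lemma dl_cross (d : ℕ) (s : Bool) : ∑ p : Fin d × Fin d, dl s p.1 p.2 p.2 p.1 =
    if s then (d:ℂ) else (d:ℂ)^2 := by
  cases s <;> simp [dl, Fintype.sum_prod_type, pow_two]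

lemma dl_par (d : ℕ) (s : Bool) : ∑ p : Fin d × Fin d, dl s p.1 p.2 p.1 p.2 =
    if s then (d:ℂ)^2 else (d:ℂ) := by
  cases s <;> simp [dl, Fintype.sum_prod_type, pow_two]

lemma dl_edge (d : ℕ) (s t : Bool) : ∑ p : Fin d × Fin d × Fin d × Fin d,
    dl s p.1 p.2.1 p.2.2.1 p.2.2.2 * dl t p.1 p.2.1 p.2.2.1 p.2.2.2 =
    if s = t then (d:ℂ)^2 else (d:ℂ) := by
  cases s <;> cases t <;> simp [dl, Fintype.sum_prod_type, pow_two]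

/-- index type: pairs for dangling legs, quadruples for edges -/
abbrev Idx (d : ℕ) := (Fin d × Fin d) × (Fin d × Fin d) × (Fin d × Fin d) ×
  (Fin d × Fin d × Fin d × Fin d) × (Fin d × Fin d × Fin d × Fin d) ×
  (Fin d × Fin d × Fin d × Fin d)

abbrev T3 (d : ℕ) := Fin d × Fin d × Fin d

abbrev Idx' (d : ℕ) := ((Fin d × Fin d × Fin d × Fin d) × Fin d × Fin d) ×
  (T3 d × T3 d × T3 d × T3 d)

/-- reindexing -/
def reidx (d : ℕ) : Idx' d ≃ Idx d where
  toFun := fun ⟨⟨⟨a₁, a₂, b₁, b₂⟩, c, c'⟩, ⟨x, y, z⟩, ⟨x', y', z'⟩, ⟨x₂, y₂, z₂⟩, ⟨x₃, y₃, z₃⟩⟩ =>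
    ((a₁, b₁), (a₂, b₂), (c, c'), (x, x', x₂, x₃), (y, y', y₂, y₃), (z, z', z₂, z₃))
  invFun := fun ⟨⟨a₁, b₁⟩, ⟨a₂, b₂⟩, ⟨c, c'⟩, ⟨x, x', x₂, x₃⟩, ⟨y, y', y₂, y₃⟩, ⟨z, z', z₂, z₃⟩⟩ =>
    (((a₁, a₂, b₁, b₂), c, c'), (x, y, z), (x', y', z'), (x₂, y₂, z₂), (x₃, y₃, z₃))
  left_inv := fun _ => rfl
  right_inv := fun _ => rfl

lemma expand {α κ τ : Type*} [Fintype α] [Fintype κ] [Fintype τ]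
    (f : α → κ → τ → ℂ) (g : α → κ → τ → ℂ) :
    ∑ a : α, (((Complex.normSq (∑ c, (∑ t, f a c t) * (starRingEnd ℂ) (∑ t, g a c t))) : ℝ) : ℂ) =
    ∑ s : (α × κ × κ) × (τ × τ × τ × τ),
      f s.1.1 s.1.2.1 s.2.1 * g s.1.1 s.1.2.2 s.2.2.1 *
       ((starRingEnd ℂ) (g s.1.1 s.1.2.1 s.2.2.2.1) * (starRingEnd ℂ) (f s.1.1 s.1.2.2 s.2.2.2.2)) := by
  rw [Fintype.sum_prod_type, Fintype.sum_prod_type]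
  refine Finset.sum_congr rfl fun a _ => ?_
  rw [← Complex.mul_conj, map_sum, Finset.sum_mul_sum, Fintype.sum_prod_type]
  refine Finset.sum_congr rfl fun c _ => Finset.sum_congr rfl fun c' _ => ?_
  simp only [Fintype.sum_prod_type]
  simp only [map_mul, Complex.conj_conj, ← Finset.mul_sum, ← Finset.sum_mul, map_sum]
  ring

lemma total (d : ℕ) (N : ℂ) : ∑ s : Idx d,
    (N * ∑ t : Bool, dl t s.1.1 s.1.2 s.1.2 s.1.1 *
      dl t s.2.2.2.1.1 s.2.2.2.1.2.1 s.2.2.2.1.2.2.1 s.2.2.2.1.2.2.2 *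
      dl t s.2.2.2.2.2.1 s.2.2.2.2.2.2.1 s.2.2.2.2.2.2.2.1 s.2.2.2.2.2.2.2.2) *
    (N * ∑ t : Bool, dl t s.2.1.1 s.2.1.2 s.2.1.2 s.2.1.1 *
      dl t s.2.2.2.1.1 s.2.2.2.1.2.1 s.2.2.2.1.2.2.1 s.2.2.2.1.2.2.2 *
      dl t s.2.2.2.2.1.1 s.2.2.2.2.1.2.1 s.2.2.2.2.1.2.2.1 s.2.2.2.2.1.2.2.2) *
    (N * ∑ t : Bool, dl t s.2.2.1.1 s.2.2.1.2 s.2.2.1.1 s.2.2.1.2 *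
      dl t s.2.2.2.2.1.1 s.2.2.2.2.1.2.1 s.2.2.2.2.1.2.2.1 s.2.2.2.2.1.2.2.2 *
      dl t s.2.2.2.2.2.1 s.2.2.2.2.2.2.1 s.2.2.2.2.2.2.2.1 s.2.2.2.2.2.2.2.2) =
    N^3 * ((d:ℂ)^7 * ((d:ℂ)+1)^2 * ((d:ℂ)^2+1)) := by
  have h : ∀ t₁ t₂ t₃ : Bool, ∑ s : Idx d, 
      dl t₁ s.1.1 s.1.2 s.1.2 s.1.1 * (dl t₂ s.2.1.1 s.2.1.2 s.2.1.2 s.2.1.1 *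
      (dl t₃ s.2.2.1.1 s.2.2.1.2 s.2.2.1.1 s.2.2.1.2 *
      ((dl t₁ s.2.2.2.1.1 s.2.2.2.1.2.1 s.2.2.2.1.2.2.1 s.2.2.2.1.2.2.2 *
        dl t₂ s.2.2.2.1.1 s.2.2.2.1.2.1 s.2.2.2.1.2.2.1 s.2.2.2.1.2.2.2) *
      ((dl t₂ s.2.2.2.2.1.1 s.2.2.2.2.1.2.1 s.2.2.2.2.1.2.2.1 s.2.2.2.2.1.2.2.2 *
        dl t₃ s.2.2.2.2.1.1 s.2.2.2.2.1.2.1 s.2.2.2.2.1.2.2.1 s.2.2.2.2.1.2.2.2) *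
      (dl t₁ s.2.2.2.2.2.1 s.2.2.2.2.2.2.1 s.2.2.2.2.2.2.2.1 s.2.2.2.2.2.2.2.2 *
        dl t₃ s.2.2.2.2.2.1 s.2.2.2.2.2.2.1 s.2.2.2.2.2.2.2.1 s.2.2.2.2.2.2.2.2))))) =
      (if t₁ then (d:ℂ) else (d:ℂ)^2) * ((if t₂ then (d:ℂ) else (d:ℂ)^2) *
      ((if t₃ then (d:ℂ)^2 else (d:ℂ)) * ((if t₁ = t₂ then (d:ℂ)^2 else (d:ℂ)) *
      ((if t₂ = t₃ then (d:ℂ)^2 else (d:ℂ)) * (if t₁ = t₃ then (d:ℂ)^2 else (d:ℂ)))))) := by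
    intro t₁ t₂ t₃
    rw [← dl_cross, ← dl_cross, ← dl_par, ← dl_edge, ← dl_edge, ← dl_edge]
    rw [Fintype.sum_prod_type, Finset.sum_mul]
    refine Finset.sum_congr rfl fun p₁ _ => ?_
    dsimp only
    rw [← Finset.mul_sum]; congr 1
    rw [Fintype.sum_prod_type, Finset.sum_mul]
    refine Finset.sum_congr rfl fun p₁ _ => ?_
    dsimp only
    rw [← Finset.mul_sum]; congr 1
    rw [Fintype.sum_prod_type, Finset.sum_mul]
    refine Finset.sum_congr rfl fun p₁ _ => ?_
    dsimp only
    rw [← Finset.mul_sum]; congr 1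
    rw [Fintype.sum_prod_type, Finset.sum_mul]
    refine Finset.sum_congr rfl fun p₁ _ => ?_
    dsimp only
    rw [← Finset.mul_sum]; congr 1
    rw [Fintype.sum_prod_type, Finset.sum_mul]
    refine Finset.sum_congr rfl fun p₁ _ => ?_
    dsimp only
    rw [← Finset.mul_sum]
  have h' : (d:ℂ)^7 * ((d:ℂ)+1)^2 * ((d:ℂ)^2+1) = ∑ t₁ : Bool, ∑ t₂ : Bool, ∑ t₃ : Bool,
      (if t₁ then (d:ℂ) else (d:ℂ)^2) * ((if t₂ then (d:ℂ) else (d:ℂ)^2) *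
      ((if t₃ then (d:ℂ)^2 else (d:ℂ)) * ((if t₁ = t₂ then (d:ℂ)^2 else (d:ℂ)) *
      ((if t₂ = t₃ then (d:ℂ)^2 else (d:ℂ)) * (if t₁ = t₃ then (d:ℂ)^2 else (d:ℂ)))))) := by
    simp [Fintype.sum_bool]; ring
  rw [h']
  simp only [← h]
  simp only [Fintype.sum_bool, ← Finset.sum_add_distrib]
  rw [Finset.mul_sum]
  refine Finset.sum_congr rfl fun s _ => ?_
  ring

set_option maxHeartbeats 2000000 in
/-- The Haar-averaged partition function `Z̄_A = E Tr[ρ_A²]` for the marginal on the two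
vertices `A = {1,2}` of the random tensor network state of the triangle graph with bond
dimension `d`: `E Σ |Σ_c Ψ(a₁,a₂,c) conj(Ψ(b₁,b₂,c))|² = (1 + d²) / ( d⁸ (d+1) (d² − d + 1)³ )`. -/
theorem stmt_16 (d : ℕ) (hd : 0 < d) (o : Fin d × Fin d × Fin d)
    (μ : Measure (Matrix.unitaryGroup (Fin d × Fin d × Fin d) ℂ))
    [μ.IsHaarMeasure] [IsProbabilityMeasure μ] :
    (∫ U₁ : Matrix.unitaryGroup (Fin d × Fin d × Fin d) ℂ,
      ∫ U₂ : Matrix.unitaryGroup (Fin d × Fin d × Fin d) ℂ,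
      ∫ U₃ : Matrix.unitaryGroup (Fin d × Fin d × Fin d) ℂ,
        (let Ψ : Fin d → Fin d → Fin d → ℂ := fun a₁ a₂ a₃ =>
          (((d : ℝ) ^ (-(3 : ℝ)/2) : ℝ) : ℂ) *
            ∑ x : Fin d, ∑ y : Fin d, ∑ z : Fin d,
              (U₁ : Matrix (Fin d × Fin d × Fin d) (Fin d × Fin d × Fin d) ℂ) (a₁, x, z) o *
                (U₂ : Matrix (Fin d × Fin d × Fin d) (Fin d × Fin d × Fin d) ℂ) (a₂, x, y) o *
                (U₃ : Matrix (Fin d × Fin d × Fin d) (Fin d × Fin d × Fin d) ℂ) (a₃, y, z) o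
         ∑ a₁ : Fin d, ∑ a₂ : Fin d, ∑ b₁ : Fin d, ∑ b₂ : Fin d,
           Complex.normSq (∑ c : Fin d, Ψ a₁ a₂ c * (starRingEnd ℂ) (Ψ b₁ b₂ c)))
        ∂μ ∂μ ∂μ)
      = (1 + (d : ℝ)^2) /
          ((d : ℝ)^8 * ((d : ℝ) + 1) * ((d : ℝ)^2 - d + 1)^3) := by
  have hd0 : (d:ℝ) ≠ 0 := by exact_mod_cast hd.ne'
  set k : ℂ := (((d : ℝ) ^ (-(3 : ℝ)/2) : ℝ) : ℂ) with hk
  have hkc : (starRingEnd ℂ) k = k := by rw [hk, Complex.conj_ofReal]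
  have hk4 : k ^ 4 = ((d:ℂ)^6)⁻¹ := by
    rw [hk, ← Complex.ofReal_pow, ← Real.rpow_natCast, ← Real.rpow_mul (by positivity)]
    have : (-(3:ℝ)/2 * ((4:ℕ):ℝ)) = -((6:ℕ):ℝ) := by norm_num
    rw [this, Real.rpow_neg (by positivity), Real.rpow_natCast]
    push_cast; rfl
  apply Complex.ofReal_injective
  simp only [← integral_complex_ofReal]
  have key : ∀ U₁ U₂ U₃ : Matrix.unitaryGroup (Fin d × Fin d × Fin d) ℂ,
      (((let Ψ : Fin d → Fin d → Fin d → ℂ := fun a₁ a₂ a₃ =>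
          k *
            ∑ x : Fin d, ∑ y : Fin d, ∑ z : Fin d,
              (U₁ : Matrix (Fin d × Fin d × Fin d) (Fin d × Fin d × Fin d) ℂ) (a₁, x, z) o *
                (U₂ : Matrix (Fin d × Fin d × Fin d) (Fin d × Fin d × Fin d) ℂ) (a₂, x, y) o *
                (U₃ : Matrix (Fin d × Fin d × Fin d) (Fin d × Fin d × Fin d) ℂ) (a₃, y, z) o
         ∑ a₁ : Fin d, ∑ a₂ : Fin d, ∑ b₁ : Fin d, ∑ b₂ : Fin d,
           Complex.normSq (∑ c : Fin d, Ψ a₁ a₂ c * (starRingEnd ℂ) (Ψ b₁ b₂ c))) : ℝ) : ℂ) =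
      ∑ s : Idx d,
        (k ^ 4 * quart o (s.1.1, s.2.2.2.1.1, s.2.2.2.2.2.1)
          (s.1.2, s.2.2.2.1.2.1, s.2.2.2.2.2.2.1) (s.1.2, s.2.2.2.1.2.2.1, s.2.2.2.2.2.2.2.1)
          (s.1.1, s.2.2.2.1.2.2.2, s.2.2.2.2.2.2.2.2) U₁) *
        quart o (s.2.1.1, s.2.2.2.1.1, s.2.2.2.2.1.1)
          (s.2.1.2, s.2.2.2.1.2.1, s.2.2.2.2.1.2.1) (s.2.1.2, s.2.2.2.1.2.2.1, s.2.2.2.2.1.2.2.1)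
          (s.2.1.1, s.2.2.2.1.2.2.2, s.2.2.2.2.1.2.2.2) U₂ *
        quart o (s.2.2.1.1, s.2.2.2.2.1.1, s.2.2.2.2.2.1)
          (s.2.2.1.2, s.2.2.2.2.1.2.1, s.2.2.2.2.2.2.1)
          (s.2.2.1.1, s.2.2.2.2.1.2.2.1, s.2.2.2.2.2.2.2.1)
          (s.2.2.1.2, s.2.2.2.2.1.2.2.2, s.2.2.2.2.2.2.2.2) U₃ := by
    intro U₁ U₂ U₃
    have hex := expand (α := Fin d × Fin d × Fin d × Fin d) (κ := Fin d) (τ := T3 d)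
      (fun a c t => k * ((U₁ : Matrix (Fin d × Fin d × Fin d) (Fin d × Fin d × Fin d) ℂ)
          (a.1, t.1, t.2.2) o *
        (U₂ : Matrix (Fin d × Fin d × Fin d) (Fin d × Fin d × Fin d) ℂ) (a.2.1, t.1, t.2.1) o *
        (U₃ : Matrix (Fin d × Fin d × Fin d) (Fin d × Fin d × Fin d) ℂ) (c, t.2.1, t.2.2) o))
      (fun a c t => k * ((U₁ : Matrix (Fin d × Fin d × Fin d) (Fin d × Fin d × Fin d) ℂ)
          (a.2.2.1, t.1, t.2.2) o *
        (U₂ : Matrix (Fin d × Fin d × Fin d) (Fin d × Fin d × Fin d) ℂ) (a.2.2.2, t.1, t.2.1) o *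
        (U₃ : Matrix (Fin d × Fin d × Fin d) (Fin d × Fin d × Fin d) ℂ) (c, t.2.1, t.2.2) o))
    refine Eq.trans ?_ (hex.trans ?_)
    · simp only [Fintype.sum_prod_type, ← Finset.mul_sum, Complex.ofReal_sum]
    · refine Fintype.sum_equiv (reidx d) _ _ ?_
      rintro ⟨⟨⟨a₁, a₂, b₁, b₂⟩, c, c'⟩, ⟨x, y, z⟩, ⟨x', y', z'⟩, ⟨x₂, y₂, z₂⟩, ⟨x₃, y₃, z₃⟩⟩
      simp only [reidx, Equiv.coe_fn_mk, quart, map_mul, hkc]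
      ring
  simp only [key]
  rw [triple_int μ (S := Idx d)
    (fun s U => k ^ 4 * quart o (s.1.1, s.2.2.2.1.1, s.2.2.2.2.2.1)
          (s.1.2, s.2.2.2.1.2.1, s.2.2.2.2.2.2.1) (s.1.2, s.2.2.2.1.2.2.1, s.2.2.2.2.2.2.2.1)
          (s.1.1, s.2.2.2.1.2.2.2, s.2.2.2.2.2.2.2.2) U)
    (fun s U => quart o (s.2.1.1, s.2.2.2.1.1, s.2.2.2.2.1.1)
          (s.2.1.2, s.2.2.2.1.2.1, s.2.2.2.2.1.2.1) (s.2.1.2, s.2.2.2.1.2.2.1, s.2.2.2.2.1.2.2.1)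
          (s.2.1.1, s.2.2.2.1.2.2.2, s.2.2.2.2.1.2.2.2) U)
    (fun s U => quart o (s.2.2.1.1, s.2.2.2.2.1.1, s.2.2.2.2.2.1)
          (s.2.2.1.2, s.2.2.2.2.1.2.1, s.2.2.2.2.2.2.1)
          (s.2.2.1.1, s.2.2.2.2.1.2.2.1, s.2.2.2.2.2.2.2.1)
          (s.2.2.1.2, s.2.2.2.2.1.2.2.2, s.2.2.2.2.2.2.2.2) U)
    (fun s => (quart_int μ _ _ _ _ _).const_mul _) (fun s => quart_int μ _ _ _ _ _)
    (fun s => quart_int μ _ _ _ _ _)]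
  simp only [integral_const_mul, mom_triple, mul_assoc (k ^ 4), ← Finset.mul_sum]
  rw [total, hk4]
  have hdc : (d:ℂ) ≠ 0 := by exact_mod_cast hd.ne'
  have h1 : (d:ℂ) + 1 ≠ 0 := by exact Nat.cast_add_one_ne_zero _
  have h2 : (d:ℂ)^2 - d + 1 ≠ 0 := by
    have h : (0:ℝ) < (d:ℝ)^2 - d + 1 := by nlinarith [sq_nonneg ((d:ℝ) - 1/2)]
    have h' := h.ne'
    exact_mod_cast h'
  have h3 : (d:ℂ)^3 + 1 = (d + 1) * ((d:ℂ)^2 - d + 1) := by ring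
  rw [h3]
  push_cast
  field_simp
  try ring
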